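/- arXiv:2205.04988 — 4 statements merged into one kernel-verified Lean document; each statement's English description precedes it below -/
import Mathlib

section
/- For natural numbers n and m with 1 ≤ m ≤ n, the identity P(n, m) = ∑_{k=0}^{n−m} ∑_{i=0}^{k} (−1)^i · Q(k, i) · P(n − k − m(i+1)) holds, where every term with negative argument of P is zero. -/
/-- `P n`, the number of integer partitions of `n`. -/
def partitionCount (n : ℕ) : ℕ := Fintype.card (Nat.Partition n)

/-- `P(n, m)`, the number of integer partitions of `n` into exactly `m` parts. -/
def partitionsInParts (n m : ℕ) : ℕ :=
  Fintype.card {p : n.Partition // p.parts.card = m}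

/-- `Q(n, m)`, the number of integer partitions of `n` into exactly `m` distinct parts. -/
def distinctPartitionsInParts (n m : ℕ) : ℕ :=
  Fintype.card {p : n.Partition // p.parts.card = m ∧ p.parts.Nodup}

open Finset

theorem partitionsInParts_eq_card_filter (n m : ℕ) :
    partitionsInParts n m = #{p : n.Partition | p.parts.card = m} :=
  Fintype.card_subtype _

/-- Partitions of `N + s.sum` whose parts include `s` correspond to partitions of `N`. -/
theorem card_filter_le_parts (N : ℕ) (s : Multiset ℕ) (hs : ∀ i ∈ s, 0 < i)
    (R : Multiset ℕ → Prop) [DecidablePred R] :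
    #{p : (N + s.sum).Partition | s ≤ p.parts ∧ R p.parts} =
      #{q : N.Partition | R (s + q.parts)} := by
  symm
  refine card_bij (fun q _ ↦ ⟨s + q.parts, ?_, ?_⟩) ?_ ?_ ?_
  · intro i hi
    rcases Multiset.mem_add.1 hi with h | h
    · exact hs i h
    · exact q.parts_pos h
  · rw [Multiset.sum_add, q.parts_sum, add_comm]
  · intro q hq
    simpa using hq
  · intro q _ q' _ h
    exact Nat.Partition.ext (add_left_cancel (congrArg Nat.Partition.parts h))
  · intro p hp
    obtain ⟨hsp, hR⟩ := (mem_filter.1 hp).2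
    obtain ⟨t, ht⟩ := Multiset.le_iff_exists_add.1 hsp
    refine ⟨⟨t, fun {i} hi ↦ p.parts_pos (ht ▸ Multiset.mem_add.2 (Or.inr hi)), ?_⟩, ?_, ?_⟩
    · have := p.parts_sum
      rw [ht, Multiset.sum_add] at this
      omega
    · simpa [← ht] using hR
    · exact Nat.Partition.ext ht.symm

/-- Removing one from each part. -/
theorem card_filter_card_parts_one_notMem (N m : ℕ) :
    #{p : (N + m).Partition | 1 ∉ p.parts ∧ p.parts.card = m} =
      #{q : N.Partition | q.parts.card = m} := by
  symm
  refine card_bij (fun q hq ↦ ⟨q.parts.map (· + 1), ?_, ?_⟩) ?_ ?_ ?_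
  · intro i hi
    obtain ⟨j, -, rfl⟩ := Multiset.mem_map.1 hi
    omega
  · rw [Multiset.sum_map_add]
    simp [q.parts_sum, (mem_filter.1 hq).2]
  · intro q hq
    have h0 : 0 ∉ q.parts := fun h ↦ (q.parts_pos h).ne rfl
    simpa [h0] using hq
  · intro q _ q' _ h
    exact Nat.Partition.ext
      (Multiset.map_injective (add_left_injective 1) (congrArg Nat.Partition.parts h))
  · intro p hp
    obtain ⟨h1, hc⟩ := (mem_filter.1 hp).2
    have hmap : (p.parts.map (· - 1)).map (· + 1) = p.parts := by
      rw [Multiset.map_map]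
      conv_rhs => rw [← Multiset.map_id p.parts]
      refine Multiset.map_congr rfl fun i hi ↦ ?_
      have := p.parts_pos hi
      simp only [Function.comp, id]
      omega
    refine ⟨⟨p.parts.map (· - 1), ?_, ?_⟩, ?_, ?_⟩
    · intro i hi
      obtain ⟨j, hj, rfl⟩ := Multiset.mem_map.1 hi
      have := p.parts_pos hj
      have : j ≠ 1 := fun h ↦ h1 (h ▸ hj)
      omega
    · have h := congrArg Multiset.sum hmap
      rw [Multiset.sum_map_add, p.parts_sum] at h
      simpa [hc] using h
    · simpa using hc
    · exact Nat.Partition.ext hmap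

theorem partitionsInParts_add_succ (N m : ℕ) :
    partitionsInParts (N + (m + 1)) (m + 1) =
      partitionsInParts (N + m) m + partitionsInParts N (m + 1) := by
  simp only [partitionsInParts_eq_card_filter]
  rw [← card_filter_card_parts_one_notMem N (m + 1),
    ← card_filter_add_card_filter_not (fun p : (N + (m + 1)).Partition ↦ 1 ∈ p.parts),
    filter_filter, filter_filter]
  congr 1
  · have h := card_filter_le_parts (N + m) {1} (by simp) (fun t ↦ t.card = m + 1)
    simp only [Multiset.singleton_le, Multiset.card_add, Multiset.card_singleton, add_comm 1,
      Nat.add_right_cancel_iff, and_comm] at h ⊢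
    exact h
  · simp only [and_comm]

theorem partitionsInParts_eq_zero_of_lt {n m : ℕ} (h : n < m) : partitionsInParts n m = 0 := by
  rw [partitionsInParts_eq_card_filter, card_eq_zero, filter_eq_empty_iff]
  rintro p - hp
  have := Multiset.card_nsmul_le_sum (s := p.parts) (a := 1) fun i hi ↦ p.parts_pos hi
  rw [p.parts_sum, hp] at this
  simp at this
  omega

theorem card_restricted_le_succ_of_lt {N m : ℕ} (h : N < m + 1) :
    #(Nat.Partition.restricted N (· ≤ m + 1)) = #(Nat.Partition.restricted N (· ≤ m)) := by
  congr 1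
  refine filter_congr fun p _ ↦ ⟨fun _ i hi ↦ ?_, fun H i hi ↦ (H i hi).trans m.le_succ⟩
  have := Nat.Partition.le_of_mem_parts hi
  omega

theorem card_restricted_le_succ (N m : ℕ) :
    #(Nat.Partition.restricted (N + (m + 1)) (· ≤ m + 1)) =
      #(Nat.Partition.restricted N (· ≤ m + 1)) +
        #(Nat.Partition.restricted (N + (m + 1)) (· ≤ m)) := by
  rw [← card_filter_add_card_filter_not
    (s := Nat.Partition.restricted (N + (m + 1)) (· ≤ m + 1)) (fun p ↦ m + 1 ∈ p.parts)]
  simp only [Nat.Partition.restricted]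
  rw [filter_filter, filter_filter]
  congr 1
  · have h := card_filter_le_parts N {m + 1} (by simp) (fun t ↦ ∀ i ∈ t, i ≤ m + 1)
    simp only [Multiset.singleton_le, Multiset.mem_add, Multiset.mem_singleton, or_imp,
      forall_and, forall_eq, le_refl, true_and, and_comm] at h ⊢
    exact h
  · congr 1
    refine filter_congr fun p _ ↦ ⟨fun H i hi ↦ ?_, fun H ↦ ⟨fun i hi ↦ ?_, fun hi ↦ ?_⟩⟩
    · exact Nat.lt_succ_iff.1 ((H.1 i hi).lt_of_ne fun h ↦ H.2 (h ▸ hi))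
    · exact (H i hi).trans m.le_succ
    · exact absurd (H _ hi) (by omega)

/-- Conjugation, numerically: partitions of `N + m` into `m` parts are equinumerous with
partitions of `N` into parts of size at most `m`. -/
theorem partitionsInParts_add_eq_card_restricted (N m : ℕ) :
    partitionsInParts (N + m) m = #(Nat.Partition.restricted N (· ≤ m)) := by
  induction m generalizing N with
  | zero =>
    rw [partitionsInParts_eq_card_filter]
    congr 1
    refine filter_congr fun p _ ↦ ?_
    rw [Multiset.card_eq_zero, Multiset.eq_zero_iff_forall_notMem]
    refine forall_congr' fun i ↦ ⟨fun h hi ↦ absurd hi h, fun h hi ↦ ?_⟩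
    exact absurd (p.parts_pos hi) (not_lt.2 (h hi))
  | succ m ih =>
    induction N using Nat.strong_induction_on with
    | _ N ihN =>
      rw [partitionsInParts_add_succ, ih]
      rcases lt_or_ge N (m + 1) with h | h
      · rw [partitionsInParts_eq_zero_of_lt h, card_restricted_le_succ_of_lt h, add_zero]
      · obtain ⟨N, rfl⟩ := Nat.exists_eq_add_of_le' h
        rw [card_restricted_le_succ, ihN N (by omega), Nat.add_comm]

theorem card_filter_subset_parts (N : ℕ) (T : Finset ℕ) (hT : ∀ i ∈ T, 0 < i) :
    #{p : N.Partition | T ⊆ p.parts.toFinset} =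
      if ∑ i ∈ T, i ≤ N then partitionCount (N - ∑ i ∈ T, i) else 0 := by
  have hsub (p : N.Partition) : T ⊆ p.parts.toFinset ↔ T.val ≤ p.parts := by
    rw [Multiset.le_iff_subset T.nodup]
    simp [Finset.subset_iff, Multiset.subset_iff]
  have hsum : T.val.sum = ∑ i ∈ T, i := sum_val T
  simp only [hsub]
  split_ifs with h
  · obtain ⟨M, rfl⟩ := Nat.exists_eq_add_of_le' h
    have := card_filter_le_parts M T.val hT (fun _ ↦ True)
    rw [hsum] at this
    simpa [partitionCount] using this
  · rw [card_eq_zero, filter_eq_empty_iff]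
    rintro p - hp
    obtain ⟨t, ht⟩ := Multiset.le_iff_exists_add.1 hp
    have := p.parts_sum
    rw [ht, Multiset.sum_add, hsum] at this
    omega

/-- Inclusion-exclusion over the set of parts exceeding `m`. -/
theorem card_restricted_le_eq_sum_powerset (N m : ℕ) :
    (#(Nat.Partition.restricted N (· ≤ m)) : ℤ) =
      ∑ T ∈ (Ioc m (N + m)).powerset, (-1 : ℤ) ^ #T *
        (if ∑ i ∈ T, i ≤ N then (partitionCount (N - ∑ i ∈ T, i) : ℤ) else 0) := by
  have hcount : ∀ T ∈ (Ioc m (N + m)).powerset, (-1 : ℤ) ^ #T *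
        (if ∑ i ∈ T, i ≤ N then (partitionCount (N - ∑ i ∈ T, i) : ℤ) else 0) =
      ∑ p : N.Partition, if T ⊆ p.parts.toFinset then (-1 : ℤ) ^ #T else 0 := by
    intro T hT
    have := card_filter_subset_parts N T fun i hi ↦
      (Nat.zero_le m).trans_lt (mem_Ioc.1 (mem_powerset.1 hT hi)).1
    rw [← sum_filter, sum_const, this]
    split_ifs <;> simp [mul_comm]
  rw [sum_congr rfl hcount, sum_comm, Nat.Partition.restricted, card_filter, Nat.cast_sum]
  refine sum_congr rfl fun p _ ↦ ?_
  have hset : {T ∈ (Ioc m (N + m)).powerset | T ⊆ p.parts.toFinset} =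
      (p.parts.toFinset.filter (m < ·)).powerset := by
    ext T
    simp only [mem_filter, mem_powerset, Finset.subset_iff, mem_Ioc, Multiset.mem_toFinset]
    refine ⟨fun h i hi ↦ ⟨h.2 hi, (h.1 hi).1⟩, fun h ↦ ⟨fun i hi ↦ ⟨(h hi).2, ?_⟩, fun i hi ↦ (h hi).1⟩⟩
    have := Nat.Partition.le_of_mem_parts (h hi).1
    omega
  rw [← sum_filter, hset, sum_powerset_neg_one_pow_card, Nat.cast_ite]
  simp [filter_eq_empty_iff]

/-- Reindexing subsets of `Ioc m (N + m)` as translates of subsets of `Ioc 0 N`. -/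
theorem sum_powerset_Ioc_add {M : Type*} [AddCommMonoid M] (N m : ℕ) (f : ℕ → ℕ → M) :
    ∑ T ∈ (Ioc m (N + m)).powerset, f (∑ i ∈ T, i) #T =
      ∑ U ∈ (Ioc 0 N).powerset, f (∑ i ∈ U, i + m * #U) #U := by
  have h : Ioc m (N + m) = (Ioc 0 N).map (addRightEmbedding m) := by
    rw [map_add_right_Ioc, zero_add]
  rw [h]
  symm
  refine sum_bij (fun U _ ↦ U.map (addRightEmbedding m)) ?_ ?_ ?_ ?_
  · intro U hU
    exact mem_powerset.2 (map_subset_map.2 (mem_powerset.1 hU))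
  · intro U _ V _ hUV
    exact map_injective _ hUV
  · intro T hT
    obtain ⟨U, hU, rfl⟩ := subset_map_iff.1 (mem_powerset.1 hT)
    exact ⟨U, mem_powerset.2 hU, rfl⟩
  · intro U _
    simp [sum_add_distrib, mul_comm]

theorem distinctPartitionsInParts_eq_card_filter {N k : ℕ} (hk : k ≤ N) (i : ℕ) :
    distinctPartitionsInParts k i =
      #{U ∈ (Ioc 0 N).powerset | ∑ j ∈ U, j = k ∧ #U = i} := by
  rw [distinctPartitionsInParts, Fintype.card_subtype]
  refine card_bij (fun p hp ↦ ⟨p.parts, (mem_filter.1 hp).2.2⟩) ?_ ?_ ?_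
  · intro p hp
    refine mem_filter.2 ⟨mem_powerset.2 fun j hj ↦ ?_, ?_, (mem_filter.1 hp).2.1⟩
    · exact mem_Ioc.2 ⟨p.parts_pos hj, (Nat.Partition.le_of_mem_parts hj).trans hk⟩
    · exact (sum_val _).symm.trans p.parts_sum
  · intro p _ q _ h
    exact Nat.Partition.ext (congrArg Finset.val h)
  · intro U hU
    obtain ⟨hU, hsum, hcard⟩ := mem_filter.1 hU
    refine ⟨⟨U.val, fun {j} hj ↦ (mem_Ioc.1 (mem_powerset.1 hU hj)).1, ?_⟩, ?_, rfl⟩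
    · exact (sum_val U).trans hsum
    · simpa using ⟨hcard, U.nodup⟩

theorem sum_distinctPartitionsInParts_mul (N : ℕ) (f : ℕ → ℕ → ℤ)
    (hf : ∀ k i, N < k → f k i = 0) :
    ∑ k ∈ range (N + 1), ∑ i ∈ range (k + 1), (distinctPartitionsInParts k i : ℤ) * f k i =
      ∑ U ∈ (Ioc 0 N).powerset, f (∑ j ∈ U, j) #U := by
  have hterm : ∀ k ∈ range (N + 1), ∀ i ∈ range (k + 1),
      (distinctPartitionsInParts k i : ℤ) * f k i =
        ∑ U ∈ (Ioc 0 N).powerset, if ∑ j ∈ U, j = k ∧ #U = i then f k i else 0 := by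
    intro k hk i _
    rw [distinctPartitionsInParts_eq_card_filter (Nat.lt_succ_iff.1 (mem_range.1 hk)),
      ← sum_filter, sum_const, nsmul_eq_mul]
  rw [sum_congr rfl fun k hk ↦ (sum_congr rfl (hterm k hk)).trans sum_comm, sum_comm]
  refine sum_congr rfl fun U hU ↦ ?_
  have hcard : #U ≤ ∑ j ∈ U, j := by
    rw [card_eq_sum_ones]
    exact sum_le_sum fun j hj ↦ (mem_Ioc.1 (mem_powerset.1 hU hj)).1
  simp only [ite_and, sum_ite_irrel, sum_const_zero, sum_ite_eq, mem_range]
  by_cases h : ∑ j ∈ U, j < N + 1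
  · rw [if_pos h, if_pos (Nat.lt_succ_iff.2 hcard)]
  · rw [if_neg h, hf _ _ (by omega)]

/-- For `1 ≤ m ≤ n`,
`P(n, m) = ∑_{k=0}^{n−m} ∑_{i=0}^{k} (−1)^i · Q(k, i) · P(n − k − m(i+1))`,
where terms with negative argument of `P` are zero. -/
theorem partitionsInParts_eq_sum_distinct (n m : ℕ) (hm : 1 ≤ m) (hmn : m ≤ n) :
    (partitionsInParts n m : ℤ) =
      ∑ k ∈ Finset.range (n - m + 1), ∑ i ∈ Finset.range (k + 1),
        (-1 : ℤ) ^ i * (distinctPartitionsInParts k i : ℤ) *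
          (if k + m * (i + 1) ≤ n then (partitionCount (n - k - m * (i + 1)) : ℤ) else 0) := by
  obtain ⟨N, rfl⟩ := Nat.exists_eq_add_of_le' hmn
  rw [partitionsInParts_add_eq_card_restricted, card_restricted_le_eq_sum_powerset,
    sum_powerset_Ioc_add N m fun s c ↦
      (-1 : ℤ) ^ c * (if s ≤ N then (partitionCount (N - s) : ℤ) else 0),
    ← sum_distinctPartitionsInParts_mul N fun k i ↦
      (-1 : ℤ) ^ i * (if k + m * i ≤ N then (partitionCount (N - (k + m * i)) : ℤ) else 0)]
  · rw [Nat.add_sub_cancel]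
    refine sum_congr rfl fun k _ ↦ sum_congr rfl fun i _ ↦ ?_
    have hle : k + m * (i + 1) ≤ N + m ↔ k + m * i ≤ N := by
      rw [mul_add, mul_one]
      omega
    have hsub : N + m - k - m * (i + 1) = N - (k + m * i) := by
      rw [mul_add, mul_one]
      omega
    simp only [hle, hsub]
    ring
  · intro k i hk
    rw [if_neg (by omega), mul_zero]
end

section
/- For every natural number n ≥ 1, P(n, 3) equals the nearest integer to n²/12; that is, P(n, 3) = ⌊n²/12 + 1/2⌋, equivalently |12·P(n, 3) − n²| ≤ 6 with P(n, 3) the unique integer within distance 1/2 of n²/12 (n² is never congruent to 6 mod 12). -/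
theorem Multiset.triple_eq_triple_of_le {α : Type*} [LinearOrder α] {a b c a' b' c' : α}
    (hab : a ≤ b) (hbc : b ≤ c) (hab' : a' ≤ b') (hbc' : b' ≤ c')
    (h : ({a, b, c} : Multiset α) = {a', b', c'}) : a = a' ∧ b = b' ∧ c = c' := by
  have hperm : [a, b, c].Perm [a', b', c'] := Multiset.coe_eq_coe.mp h
  have heq : [a, b, c] = [a', b', c'] :=
    hperm.eq_of_pairwise' (r := (· ≤ ·))
      (by simp [hab, hbc, hab.trans hbc]) (by simp [hab', hbc', hab'.trans hbc'])
  simpa using heq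

theorem Multiset.exists_le_triple_of_card_eq_three {α : Type*} [LinearOrder α] {s : Multiset α}
    (hs : s.card = 3) : ∃ a b c, a ≤ b ∧ b ≤ c ∧ s = {a, b, c} := by
  obtain ⟨a, b, c, h⟩ := List.length_eq_three.mp ((s.length_sort (· ≤ ·)).trans hs)
  have hsort := s.pairwise_sort (· ≤ ·)
  rw [h] at hsort
  simp only [List.pairwise_cons, List.mem_cons] at hsort
  refine ⟨a, b, c, hsort.1 b (by simp), hsort.2.1 c (by simp), ?_⟩
  rw [← s.sort_eq (· ≤ ·), h]
  rfl

/-- Counting partitions into three parts by the smallest part, which is `a + 1`. -/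
theorem partitionsInParts_three_eq_sum (n : ℕ) :
    partitionsInParts n 3 = ∑ a ∈ Finset.range (n / 3), ((n - a - 1) / 2 - a) := by
  have hcard : ((Finset.range (n / 3)).sigma
      fun a => Finset.Ico (a + 1) ((n - a - 1) / 2 + 1)).card =
      ∑ a ∈ Finset.range (n / 3), ((n - a - 1) / 2 - a) := by
    simp [Finset.card_sigma]
  rw [← hcard, partitionsInParts, Fintype.card]
  symm
  refine Finset.card_bij
    (fun x hx => ⟨⟨{x.1 + 1, x.2, n - (x.1 + 1) - x.2}, ?_, ?_⟩, rfl⟩) ?_ ?_ ?_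
  · simp only [Finset.mem_sigma, Finset.mem_range, Finset.mem_Ico] at hx
    intro i hi
    simp only [Multiset.insert_eq_cons, Multiset.mem_cons, Multiset.mem_singleton] at hi
    omega
  · simp only [Finset.mem_sigma, Finset.mem_range, Finset.mem_Ico] at hx
    simp only [Multiset.insert_eq_cons, Multiset.sum_cons, Multiset.sum_singleton]
    omega
  · exact fun _ _ => Finset.mem_univ _
  · rintro ⟨a, b⟩ hx ⟨a', b'⟩ hx' h
    simp only [Finset.mem_sigma, Finset.mem_range, Finset.mem_Ico] at hx hx'
    have hparts : ({a + 1, b, n - (a + 1) - b} : Multiset ℕ) =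
        {a' + 1, b', n - (a' + 1) - b'} := congrArg (fun p => p.1.parts) h
    obtain ⟨ha, rfl, -⟩ := Multiset.triple_eq_triple_of_le
      (by omega) (by omega) (by omega) (by omega) hparts
    obtain rfl : a = a' := by omega
    rfl
  · rintro ⟨⟨s, hpos, hsum⟩, hs⟩ -
    obtain ⟨a, b, c, hab, hbc, rfl⟩ := Multiset.exists_le_triple_of_card_eq_three hs
    have ha : 0 < a := hpos (by simp)
    simp only [Multiset.insert_eq_cons, Multiset.sum_cons, Multiset.sum_singleton] at hsum
    refine ⟨⟨a - 1, b⟩, ?_, ?_⟩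
    · simp only [Finset.mem_sigma, Finset.mem_range, Finset.mem_Ico]
      omega
    · refine Subtype.ext (Nat.Partition.ext ?_)
      change ({a - 1 + 1, b, n - (a - 1 + 1) - b} : Multiset ℕ) = {a, b, c}
      rw [show a - 1 + 1 = a by omega, show n - a - b = c by omega]

theorem partitionsInParts_three_add_three (n : ℕ) :
    partitionsInParts (n + 3) 3 = partitionsInParts n 3 + (n + 2) / 2 := by
  rw [partitionsInParts_three_eq_sum, partitionsInParts_three_eq_sum,
    show (n + 3) / 3 = n / 3 + 1 by omega, Finset.sum_range_succ']
  congr 1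
  refine Finset.sum_congr rfl fun a ha => ?_
  rw [Finset.mem_range] at ha
  omega

theorem partitionsInParts_three_add_six (n : ℕ) :
    partitionsInParts (n + 6) 3 = partitionsInParts n 3 + n + 3 := by
  rw [partitionsInParts_three_add_three (n + 3), partitionsInParts_three_add_three n]
  omega

/-- For `n ≥ 1`, `P(n, 3)` is the nearest integer to `n²/12`, i.e.
`P(n, 3) = ⌊n²/12 + 1/2⌋`. -/
theorem partitionsInParts_three (n : ℕ) (hn : 1 ≤ n) :
    (partitionsInParts n 3 : ℤ) = round ((n : ℚ) ^ 2 / 12) := by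
  clear hn
  induction n using Nat.strong_induction_on with
  | _ n ih =>
    rcases lt_or_ge n 6 with hn | hn
    · symm
      rw [round_eq_iff, partitionsInParts_three_eq_sum]
      interval_cases n <;> norm_num [Finset.sum_range_succ]
    · obtain ⟨k, rfl⟩ := Nat.exists_eq_add_of_le' hn
      have hsq : ((k + 6 : ℕ) : ℚ) ^ 2 / 12 = (k : ℚ) ^ 2 / 12 + ((k + 3 : ℕ) : ℚ) := by
        push_cast
        ring
      rw [hsq, round_add_natCast, ← ih k (by omega), partitionsInParts_three_add_six]
      push_cast
      ring
end

section
/- For every natural number n ≥ 1, Euler's pentagonal-number recurrence holds: P(n) = −∑_{k=1}^{∞} (−1)^k ( P(n − k(3k−1)/2) + P(n − k(3k+1)/2) ), where the sum is over all positive integers k for which the argument of P is nonnegative, and P of a negative argument is 0. Equivalently, for all n ≥ 0: ∑_{k∈ℤ} (−1)^k P(n − k(3k−1)/2) = (1 if n = 0 else 0), the sum ranging over the finitely many integers k with n − k(3k−1)/2 ≥ 0. -/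
open PowerSeries PowerSeries.WithPiTopology in
/-- The product of the generating function of partitions and `∏ (1 - X ^ (n + 1))` is `1`. -/
theorem mk_partitionCount_mul_pentagonalSeries :
    (PowerSeries.mk fun n ↦ (partitionCount n : ℤ)) * pentagonalSeries ℤ = 1 := by
  have hP : HasProd (fun i ↦ ∑' j : ℕ, (X : ℤ⟦X⟧) ^ ((i + 1) * j))
      (PowerSeries.mk fun n ↦ (partitionCount n : ℤ)) := by
    simpa [Nat.Partition.restricted, partitionCount] using
      Nat.Partition.hasProd_powerSeriesMk_card_restricted ℤ fun _ ↦ True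
  refine (hP.mul (hasProd_one_sub_X_pow ℤ)).unique ?_
  convert! hasProd_one using 2 with i
  simp_rw [pow_mul]
  exact tsum_pow_mul_one_sub_of_constantCoeff_eq_zero (by simp)

open PowerSeries PowerSeries.WithPiTopology in
theorem hasSum_negOnePow_mul_partitionCount_sub_pentagonal (n : ℕ) :
    HasSum (fun k : ℤ ↦ (Int.negOnePow k : ℤ) *
      if pentagonal k ≤ n then (partitionCount (n - pentagonal k) : ℤ) else 0)
      (if n = 0 then 1 else 0) := by
  have h := ((hasSum_pentagonalSeries ℤ).mul_left
    (PowerSeries.mk fun n ↦ (partitionCount n : ℤ))).map (coeff n) (continuous_coeff ℤ n)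
  rw [mk_partitionCount_mul_pentagonalSeries, coeff_one] at h
  convert! h using 2 with k
  have hk : ((Int.negOnePow k : ℤ) : ℤ⟦X⟧) = C (Int.negOnePow k : ℤ) := by simp
  rw [Function.comp_apply, hk, mul_left_comm, coeff_C_mul, coeff_mul_X_pow', coeff_mk]

theorem pentagonal_natCast (k : ℕ) : pentagonal k = k * (3 * k - 1) / 2 := by
  rcases k with _ | k
  · simp [pentagonal_def]
  · zify
    rw [natCast_pentagonal, Nat.cast_sub (by omega)]
    push_cast
    ring_nf

theorem pentagonal_neg_natCast (k : ℕ) : pentagonal (-k) = k * (3 * k + 1) / 2 := by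
  rw [pentagonal_neg]
  exact_mod_cast Int.toNat_natCast (k * (3 * k + 1) / 2)

theorem natAbs_le_pentagonal (k : ℤ) : k.natAbs ≤ pentagonal k := by
  have h := two_mul_natCast_pentagonal k
  zify
  rcases abs_cases k with ⟨h1, h2⟩ | ⟨h1, h2⟩ <;>
    rw [h1] <;> nlinarith [sq_nonneg k, Int.le_self_sq k]

/-- Euler's pentagonal number recurrence: for `n ≥ 1`,
`P(n) = −∑_{k=1}^{∞} (−1)^k (P(n − k(3k−1)/2) + P(n − k(3k+1)/2))`,
where terms with negative argument of `P` are zero.  All nonzero terms have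
`k ≤ n`, so the sum is taken over `1 ≤ k ≤ n`. -/
theorem euler_pentagonal_recurrence (n : ℕ) (hn : 1 ≤ n) :
    (partitionCount n : ℤ) =
      -∑ k ∈ Finset.Icc 1 n,
        (-1 : ℤ) ^ k *
          ((if k * (3 * k - 1) / 2 ≤ n then
              (partitionCount (n - k * (3 * k - 1) / 2) : ℤ) else 0) +
            (if k * (3 * k + 1) / 2 ≤ n then
              (partitionCount (n - k * (3 * k + 1) / 2) : ℤ) else 0)) := by
  have h := (hasSum_negOnePow_mul_partitionCount_sub_pentagonal n).nat_add_neg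
  have h0 := h.unique (hasSum_sum_of_ne_finset_zero (s := Finset.range (n + 1)) fun k hk ↦ by
    have h1 := natAbs_le_pentagonal k
    have h2 := natAbs_le_pentagonal (-k)
    rw [Finset.mem_range] at hk
    rw [if_neg (by omega), if_neg (by omega)]
    simp)
  rw [Finset.sum_range_eq_add_Ico _ (show 0 < n + 1 by omega)] at h0
  simp only [pentagonal_neg_natCast, pentagonal_natCast, Int.negOnePow_neg,
    Int.coe_negOnePow_natCast, ← mul_add] at h0
  rw [← Finset.Ico_add_one_right_eq_Icc]
  simp only [Int.negOnePow_zero, Units.val_one, one_mul,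
    pentagonal_def, zero_mul, Int.zero_ediv, Int.toNat_zero, Nat.zero_div, Nat.zero_le, if_true,
    Nat.sub_zero, pow_zero, if_neg (show n ≠ 0 by omega)] at h0
  linarith
end

section
/- For every natural number n ≥ 1, Merca's recurrence holds: Q(n) = s(n) − 2·∑_{k=1}^{∞} (−1)^k Q(n − 3k²), where the sum is over all positive integers k with n − 3k² ≥ 0, and s(n) = 1 if n = m(3m−1)/2 or n = m(3m+1)/2 for some nonnegative integer m (i.e., n is a generalized pentagonal number), and s(n) = 0 otherwise. -/
/-- `Q n`, the number of integer partitions of `n` into pairwise distinct parts. -/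
def distinctPartitionCount (n : ℕ) : ℕ :=
  Fintype.card {p : n.Partition // p.parts.Nodup}

namespace Merca

open Finset PowerSeries

/-- The triangular number `k(k+1)/2` of an integer `k`. -/
def triangular (k : ℤ) : ℕ := (k * (k + 1) / 2).toNat

theorem two_mul_triangular (k : ℤ) : 2 * (triangular k : ℤ) = k * (k + 1) := by
  have h0 : 0 ≤ k * (k + 1) := by
    rcases le_or_gt 0 k with h | h
    · positivity
    · nlinarith
  have h1 : 2 * (k * (k + 1) / 2) = k * (k + 1) :=
    Int.two_mul_ediv_two_of_even (Int.even_mul_succ_self k)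
  unfold triangular
  omega

section Theta

variable {R : Type*} [CommRing R]

/-- The general term `a^(k(k+1)/2) * b^(k(k-1)/2)` of Ramanujan's theta series. -/
def thetaTerm (a b : R) (k : ℤ) : R := a ^ triangular k * b ^ triangular (-k)

theorem thetaTerm_add_one (a b : R) {k : ℤ} {u v : ℕ} (h : (u : ℤ) + k = v) :
    (a * b) ^ u * thetaTerm a b (k + 1) = a * (a * b) ^ v * thetaTerm a b k := by
  have h1 := two_mul_triangular k
  have h2 := two_mul_triangular (-k)
  have h3 := two_mul_triangular (k + 1)
  have h4 := two_mul_triangular (-(k + 1))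
  have ha : u + triangular (k + 1) = 1 + v + triangular k := by zify; linarith
  have hb : u + triangular (-(k + 1)) = v + triangular (-k) := by zify; linarith
  calc (a * b) ^ u * thetaTerm a b (k + 1)
      = a ^ (u + triangular (k + 1)) * b ^ (u + triangular (-(k + 1))) := by
        rw [thetaTerm]; ring
    _ = a * (a * b) ^ v * thetaTerm a b k := by rw [ha, hb, thetaTerm]; ring

theorem thetaTerm_swap (a b : R) (k : ℤ) : thetaTerm b a (-k) = thetaTerm a b k := by
  simp [thetaTerm, mul_comm]

theorem thetaTerm_sub_one (a b : R) {k : ℤ} {u v : ℕ} (h : (u : ℤ) = v + k) :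
    (a * b) ^ u * thetaTerm a b (k - 1) = b * (a * b) ^ v * thetaTerm a b k := by
  rw [← thetaTerm_swap, ← thetaTerm_swap a b k, show -(k - 1) = -k + 1 by ring, mul_comm a b]
  exact thetaTerm_add_one b a (by omega)

/-- Splitting `1 - q ^ (n + 1)` along an antidiagonal: the `q`-Pascal rule. -/
theorem one_sub_pow_mul_sum_antidiagonal {q : R} {w : ℕ → R}
    (hw : ∀ p, w (p + 1) * (1 - q ^ (p + 1)) = w p) (n : ℕ) (g : ℕ → R) :
    (1 - q ^ (n + 1)) * ∑ p ∈ antidiagonal (n + 1), w p.1 * w p.2 * g p.1 =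
      ∑ p ∈ antidiagonal n, w p.1 * w p.2 * (g p.1 + q ^ p.2 * g (p.1 + 1)) := by
  have h : (1 - q ^ (n + 1)) * ∑ p ∈ antidiagonal (n + 1), w p.1 * w p.2 * g p.1 =
      ∑ p ∈ antidiagonal (n + 1), w p.1 * (w p.2 * (1 - q ^ p.2)) * g p.1 +
      ∑ p ∈ antidiagonal (n + 1), (w p.1 * (1 - q ^ p.1)) * w p.2 * (q ^ p.2 * g p.1) := by
    rw [mul_sum, ← sum_add_distrib]
    refine sum_congr rfl fun p hp ↦ ?_
    rw [← mem_antidiagonal.mp hp]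
    ring
  rw [h, Nat.sum_antidiagonal_succ', Nat.sum_antidiagonal_succ]
  simp only [pow_zero, sub_self, mul_zero, zero_mul, zero_add, hw]
  rw [← sum_add_distrib]
  exact sum_congr rfl fun p _ ↦ by ring

/-- The mirror image of `one_sub_pow_mul_sum_antidiagonal`. -/
theorem one_sub_pow_mul_sum_antidiagonal' {q : R} {w : ℕ → R}
    (hw : ∀ p, w (p + 1) * (1 - q ^ (p + 1)) = w p) (n : ℕ) (g : ℕ → R) :
    (1 - q ^ (n + 1)) * ∑ p ∈ antidiagonal (n + 1), w p.1 * w p.2 * g p.1 =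
      ∑ p ∈ antidiagonal n, w p.1 * w p.2 * (g (p.1 + 1) + q ^ p.1 * g p.1) := by
  have h : (1 - q ^ (n + 1)) * ∑ p ∈ antidiagonal (n + 1), w p.1 * w p.2 * g p.1 =
      ∑ p ∈ antidiagonal (n + 1), (w p.1 * (1 - q ^ p.1)) * w p.2 * g p.1 +
      ∑ p ∈ antidiagonal (n + 1), w p.1 * (w p.2 * (1 - q ^ p.2)) * (q ^ p.1 * g p.1) := by
    rw [mul_sum, ← sum_add_distrib]
    refine sum_congr rfl fun p hp ↦ ?_
    rw [← mem_antidiagonal.mp hp]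
    ring
  rw [h, Nat.sum_antidiagonal_succ, Nat.sum_antidiagonal_succ']
  simp only [pow_zero, sub_self, mul_zero, zero_mul, zero_add, hw]
  rw [← sum_add_distrib]
  exact sum_congr rfl fun p _ ↦ by ring

/-- The finite Jacobi triple product, with `w p` in the role of `1 / ((1 - q) ⋯ (1 - q ^ p))`
for `q = a * b`. -/
theorem finite_triple_product (a b : R) {w : ℕ → R} (hw0 : w 0 = 1)
    (hw : ∀ p, w (p + 1) * (1 - (a * b) ^ (p + 1)) = w p) (M N : ℕ) :
    (∏ i ∈ range M, (1 + a * (a * b) ^ i)) * ∏ i ∈ range N, (1 + b * (a * b) ^ i) =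
      (∏ i ∈ range (M + N), (1 - (a * b) ^ (i + 1))) *
        ∑ p ∈ antidiagonal (M + N), w p.1 * w p.2 * thetaTerm a b (p.1 - N) := by
  induction M with
  | zero =>
    induction N with
    | zero => simp [hw0, thetaTerm, triangular]
    | succ N ih =>
      simp only [range_zero, prod_empty, one_mul, zero_add] at ih ⊢
      rw [prod_range_succ, ih, prod_range_succ, mul_assoc, mul_assoc,
        one_sub_pow_mul_sum_antidiagonal' hw N fun p ↦ thetaTerm a b (p - (N + 1 : ℕ)), sum_mul]
      congr 1
      refine sum_congr rfl fun p _ ↦ ?_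
      have h := thetaTerm_sub_one a b (k := p.1 - N) (u := p.1) (v := N) (by ring)
      push_cast
      rw [show (p.1 + 1 - (N + 1) : ℤ) = p.1 - N by ring,
        show (p.1 - (N + 1) : ℤ) = p.1 - N - 1 by ring, h]
      ring
  | succ M ih =>
    rw [prod_range_succ, mul_right_comm, ih, show M + 1 + N = M + N + 1 by ring,
      prod_range_succ _ (M + N), mul_assoc, mul_assoc,
      one_sub_pow_mul_sum_antidiagonal hw (M + N) fun p ↦ thetaTerm a b (p - N), sum_mul]
    congr 1
    refine sum_congr rfl fun p hp ↦ ?_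
    have hp := mem_antidiagonal.mp hp
    have h := thetaTerm_add_one a b (k := p.1 - N) (u := p.2) (v := M) (by omega)
    push_cast
    rw [show (p.1 + 1 - N : ℤ) = p.1 - N + 1 by ring, h]
    ring

theorem prod_range_eq_of_pow_eq_zero {q : R} {m n : ℕ} (hq : q ^ m = 0) (hn : m ≤ n) :
    ∏ i ∈ range n, (1 - q ^ (i + 1)) = ∏ i ∈ range m, (1 - q ^ (i + 1)) := by
  refine (prod_subset (range_subset_range.mpr hn) fun i _ hi ↦ ?_).symm
  rw [pow_eq_zero_of_le (by simp at hi; omega) hq, sub_zero]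

theorem isUnit_prod_one_sub_pow {q : R} (hq : IsNilpotent q) (n : ℕ) :
    IsUnit (∏ i ∈ range n, (1 - q ^ (i + 1))) := by
  rw [IsUnit.prod_iff]
  exact fun i _ ↦ (hq.pow_succ i).isUnit_one_sub

/-- The Jacobi triple product for `a * b` nilpotent, when the far terms of the theta series
vanish. -/
theorem triple_product {a b : R} {m N : ℕ} (hq : (a * b) ^ m = 0)
    (hf : ∀ k : ℤ, m ≤ k.natAbs → thetaTerm a b k = 0) (hN : 2 * m ≤ N) :
    (∏ i ∈ range N, (1 + a * (a * b) ^ i)) * (∏ i ∈ range N, (1 + b * (a * b) ^ i)) *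
      ∏ i ∈ range N, (1 - (a * b) ^ (i + 1)) =
      ∑ k ∈ Icc (-N : ℤ) N, thetaTerm a b k := by
  set e : ℕ → R := fun n ↦ ∏ i ∈ range n, (1 - (a * b) ^ (i + 1))
  have he (n : ℕ) : IsUnit (e n) := isUnit_prod_one_sub_pow ⟨m, hq⟩ n
  have hem (n : ℕ) (hn : m ≤ n) : e n = e m := prod_range_eq_of_pow_eq_zero hq hn
  have hw (p : ℕ) : Ring.inverse (e (p + 1)) * (1 - (a * b) ^ (p + 1)) = Ring.inverse (e p) := by
    have h1 := Ring.inverse_mul_cancel _ (he (p + 1))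
    have h2 := Ring.mul_inverse_cancel _ (he p)
    have h3 : e (p + 1) = e p * (1 - (a * b) ^ (p + 1)) := prod_range_succ _ _
    linear_combination Ring.inverse (e p) * h1 - Ring.inverse (e p) * Ring.inverse (e (p + 1)) * h3
      - Ring.inverse (e (p + 1)) * (1 - (a * b) ^ (p + 1)) * h2
  have hsum : ∑ p ∈ antidiagonal (N + N),
      Ring.inverse (e p.1) * Ring.inverse (e p.2) * thetaTerm a b (p.1 - N) =
      Ring.inverse (e m) * Ring.inverse (e m) * ∑ k ∈ Icc (-N : ℤ) N, thetaTerm a b k := by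
    rw [mul_sum]
    refine sum_bij (fun p _ ↦ (p.1 - N : ℤ)) ?_ ?_ ?_ ?_
    · intro p hp
      have := mem_antidiagonal.mp hp
      rw [mem_Icc]
      omega
    · intro p hp r hr h
      have := mem_antidiagonal.mp hp
      have := mem_antidiagonal.mp hr
      ext <;> omega
    · intro k hk
      rw [mem_Icc] at hk
      exact ⟨((k + N).toNat, (N - k).toNat), by rw [HasAntidiagonal.mem_antidiagonal]; omega, by simp; omega⟩
    · intro p hp
      have := mem_antidiagonal.mp hp
      by_cases h : m ≤ (p.1 - N : ℤ).natAbs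
      · simp [hf _ h]
      · rw [hem p.1 (by omega), hem p.2 (by omega)]
  rw [finite_triple_product a b (w := fun p ↦ Ring.inverse (e p)) (by simp [e]) hw, hsum]
  change e (N + N) * _ * e N = _
  rw [hem (N + N) (by omega), hem N (by omega)]
  have h := Ring.mul_inverse_cancel _ (he m)
  linear_combination (e m * Ring.inverse (e m) + 1) * (∑ k ∈ Icc (-N : ℤ) N, thetaTerm a b k) * h

theorem prod_range_two_mul {M : Type*} [CommMonoid M] (f : ℕ → M) (n : ℕ) :
    ∏ i ∈ range (2 * n), f i = (∏ i ∈ range n, f (2 * i)) * ∏ i ∈ range n, f (2 * i + 1) := by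
  induction n with
  | zero => simp
  | succ n ih =>
    rw [mul_add_one, prod_range_succ, prod_range_succ, ih, prod_range_succ, prod_range_succ]
    ac_rfl

theorem prod_range_three_mul {M : Type*} [CommMonoid M] (f : ℕ → M) (n : ℕ) :
    ∏ i ∈ range (3 * n), f i = (∏ i ∈ range n, f (3 * i)) * (∏ i ∈ range n, f (3 * i + 1)) *
      ∏ i ∈ range n, f (3 * i + 2) := by
  induction n with
  | zero => simp
  | succ n ih =>
    rw [mul_add_one, prod_range_succ, prod_range_succ, prod_range_succ, ih, prod_range_succ,
      prod_range_succ, prod_range_succ]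
    ac_rfl

/-- Gauss's product for the alternating theta series, in a ring where `y` is nilpotent. -/
theorem prod_one_add_mul_prod_sq {y : R} {m N : ℕ} (hy : y ^ m = 0) (hN : m ≤ N) :
    (∏ i ∈ range N, (1 + y ^ (i + 1))) * ((∏ i ∈ range N, (1 - y ^ (2 * i + 1))) *
      (∏ i ∈ range N, (1 - y ^ (2 * i + 1))) * ∏ i ∈ range N, (1 - y ^ (2 * i + 1 + 1))) =
      ∏ i ∈ range N, (1 - y ^ (i + 1)) := by
  have h1 : (∏ i ∈ range N, (1 - y ^ (2 * i + 1))) * ∏ i ∈ range N, (1 - y ^ (2 * i + 1 + 1)) =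
      ∏ i ∈ range N, (1 - y ^ (i + 1)) := by
    rw [← prod_range_two_mul fun i ↦ 1 - y ^ (i + 1),
      prod_range_eq_of_pow_eq_zero hy (n := 2 * N) (by omega), prod_range_eq_of_pow_eq_zero hy hN]
  have h2 : (∏ i ∈ range N, (1 + y ^ (i + 1))) * ∏ i ∈ range N, (1 - y ^ (i + 1)) =
      ∏ i ∈ range N, (1 - y ^ (2 * i + 1 + 1)) := by
    rw [← prod_mul_distrib]
    exact prod_congr rfl fun i _ ↦ by ring
  calc _ = ((∏ i ∈ range N, (1 + y ^ (i + 1))) * ∏ i ∈ range N, (1 - y ^ (i + 1))) *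
        ∏ i ∈ range N, (1 - y ^ (2 * i + 1)) := by rw [← h1]; ring
    _ = _ := by rw [h2, mul_comm, h1]

theorem thetaTerm_self_sq (x : R) (k : ℤ) :
    thetaTerm x (x ^ 2) k = x ^ pentagonal k := by
  have h1 := two_mul_triangular k
  have h2 := two_mul_triangular (-k)
  have h3 := two_mul_natCast_pentagonal k
  rw [thetaTerm, ← pow_mul, ← pow_add]
  congr 1
  zify
  linarith

theorem thetaTerm_neg_cube (x : R) (k : ℤ) :
    thetaTerm (-x ^ 3) (-x ^ 3) k = (-1) ^ k.natAbs * x ^ (3 * k.natAbs ^ 2) := by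
  have h1 := two_mul_triangular k
  have h2 := two_mul_triangular (-k)
  have h : triangular k + triangular (-k) = k.natAbs ^ 2 := by zify; rw [sq_abs]; linarith
  rw [thetaTerm, ← pow_add, h, neg_pow, ← pow_mul]
  congr 1
  rcases Nat.even_or_odd k.natAbs with hk | hk
  · rw [hk.neg_one_pow, (hk.pow_of_ne_zero two_ne_zero).neg_one_pow]
  · rw [hk.neg_one_pow, hk.pow.neg_one_pow]

theorem natAbs_le_pentagonal (k : ℤ) : k.natAbs ≤ pentagonal k := by
  have h := two_mul_natCast_pentagonal k
  zify
  rcases lt_trichotomy k 0 with hk | rfl | hk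
  · rw [abs_of_neg hk]; nlinarith
  · simp
  · rw [abs_of_pos hk]; nlinarith

/-- The product form of the identity behind Merca's recurrence. -/
theorem prod_one_add_pow_mul_sum {x : R} {m N : ℕ} (hx : x ^ m = 0) (hN : 2 * m ≤ N) :
    (∏ i ∈ range (3 * N), (1 + x ^ (i + 1))) *
      ∑ k ∈ Icc (-N : ℤ) N, (-1) ^ k.natAbs * x ^ (3 * k.natAbs ^ 2) =
      ∑ k ∈ Icc (-N : ℤ) N, x ^ pentagonal k := by
  have hx' {j : ℕ} (hj : m ≤ j) : x ^ j = 0 := pow_eq_zero_of_le hj hx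
  have h1 := triple_product (a := x) (b := x ^ 2) (m := m) (N := N)
    (by rw [← pow_succ', ← pow_mul]; exact hx' (by omega))
    (fun k hk ↦ by rw [thetaTerm_self_sq]; exact hx' (hk.trans (natAbs_le_pentagonal k))) hN
  have h2 := triple_product (a := -x ^ 3) (b := -x ^ 3) (m := m) (N := N)
    (by rw [neg_mul_neg, ← pow_add, ← pow_mul]; exact hx' (by omega))
    (fun k hk ↦ by
      rw [thetaTerm_neg_cube, hx' (by nlinarith), mul_zero]) hN
  simp only [thetaTerm_self_sq] at h1
  simp only [thetaTerm_neg_cube] at h2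
  have h3 := prod_one_add_mul_prod_sq (y := x ^ 3) (m := m) (N := N)
    (by rw [← pow_mul]; exact hx' (by omega)) (by omega)
  rw [← h1, ← h2, prod_range_three_mul]
  have e1 (i : ℕ) : 1 + -x ^ 3 * (-x ^ 3 * -x ^ 3) ^ i = 1 - (x ^ 3) ^ (2 * i + 1) := by ring
  have e2 (i : ℕ) : 1 - (-x ^ 3 * -x ^ 3) ^ (i + 1) = 1 - (x ^ 3) ^ (2 * i + 1 + 1) := by ring
  have e3 (i : ℕ) : 1 - (x * x ^ 2) ^ (i + 1) = 1 - (x ^ 3) ^ (i + 1) := by ring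
  have e4 (i : ℕ) : 1 + x ^ (3 * i + 2 + 1) = 1 + (x ^ 3) ^ (i + 1) := by ring
  have e5 (i : ℕ) : 1 + x ^ (3 * i + 1) = 1 + x * (x * x ^ 2) ^ i := by ring
  have e6 (i : ℕ) : 1 + x ^ (3 * i + 1 + 1) = 1 + x ^ 2 * (x * x ^ 2) ^ i := by ring
  simp only [e1, e2, e3, e4, e5, e6]
  rw [← h3, mul_assoc]

end Theta

theorem distinctPartitionCount_eq_card_distincts (n : ℕ) :
    distinctPartitionCount n = #(Nat.Partition.distincts n) := by
  rw [distinctPartitionCount, Fintype.card_subtype, Nat.Partition.distincts]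

/-- The generating function of `distinctPartitionCount`. -/
noncomputable def distinctSeries : ℤ⟦X⟧ := .mk fun n ↦ (distinctPartitionCount n : ℤ)

theorem eventually_coeff_prod_eq (j : ℕ) : ∀ᶠ M in Filter.atTop,
    (∏ i ∈ range M, (1 + X ^ (i + 1) : ℤ⟦X⟧)).coeff j = distinctSeries.coeff j := by
  let : TopologicalSpace ℤ := ⊥
  have : DiscreteTopology ℤ := ⟨rfl⟩
  open scoped PowerSeries.WithPiTopology in
  have h := (Nat.Partition.hasProd_powerSeriesMk_card_countRestricted ℤ two_pos).tendsto_prod_nat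
  rw [WithPiTopology.tendsto_iff_coeff_tendsto] at h
  have h := h j
  have hsum (i : ℕ) : ∑ k ∈ range 2, X ^ ((i + 1) * k) = (1 + X ^ (i + 1) : ℤ⟦X⟧) := by
    rw [sum_range_succ, sum_range_one]
    simp
  simp only [nhds_discrete, Filter.tendsto_pure,
    Nat.Partition.countRestricted_two] at h
  simpa [distinctSeries, distinctPartitionCount_eq_card_distincts, hsum] using h

/-- Merca's recurrence as an identity of power series up to degree `n`. -/
theorem exists_coeff_distinctSeries_mul_sum (n : ℕ) : ∃ N, n ≤ N ∧
    (distinctSeries * ∑ k ∈ Icc (-N : ℤ) N, (-1) ^ k.natAbs * X ^ (3 * k.natAbs ^ 2)).coeff n =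
      (∑ k ∈ Icc (-N : ℤ) N, (X : ℤ⟦X⟧) ^ pentagonal k).coeff n := by
  have h : ∀ᶠ M in Filter.atTop, ∀ j ∈ range (n + 1),
      (∏ i ∈ range M, (1 + X ^ (i + 1) : ℤ⟦X⟧)).coeff j = distinctSeries.coeff j := by
    rw [Filter.eventually_all_finset]
    exact fun j _ ↦ eventually_coeff_prod_eq j
  obtain ⟨K, hK⟩ := Filter.eventually_atTop.mp h
  refine ⟨2 * (n + 1) + K, by omega, ?_⟩
  set N := 2 * (n + 1) + K
  let φ := Ideal.Quotient.mk (Ideal.span {(X : ℤ⟦X⟧) ^ (n + 1)})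
  have hφ (f g : ℤ⟦X⟧) : φ f = φ g ↔ ∀ j < n + 1, f.coeff j = g.coeff j := by
    rw [Ideal.Quotient.eq, Ideal.mem_span_singleton, X_pow_dvd_iff]
    simp [sub_eq_zero]
  have hX : φ X ^ (n + 1) = 0 := by
    rw [← map_pow, Ideal.Quotient.eq_zero_iff_mem]
    exact Ideal.mem_span_singleton_self _
  have hD : φ distinctSeries = ∏ i ∈ range (3 * N), (1 + φ X ^ (i + 1)) := by
    rw [show ∏ i ∈ range (3 * N), (1 + φ X ^ (i + 1)) =
      φ (∏ i ∈ range (3 * N), (1 + X ^ (i + 1))) by simp, hφ]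
    exact fun j hj ↦ (hK (3 * N) (by omega) j (mem_range.mpr hj)).symm
  refine (hφ _ _).mp ?_ n n.lt_succ_self
  simpa [hD] using prod_one_add_pow_mul_sum (N := N) hX (by omega)

theorem sum_Icc_neg_natAbs (g : ℕ → ℤ) (N : ℕ) :
    ∑ k ∈ Icc (-N : ℤ) N, g k.natAbs = g 0 + 2 * ∑ k ∈ Icc 1 N, g k := by
  induction N with
  | zero => simp
  | succ N ih =>
    have h : Icc (-(N + 1 : ℕ) : ℤ) (N + 1 : ℕ) =
        insert (-(N + 1 : ℕ) : ℤ) (insert ((N + 1 : ℕ) : ℤ) (Icc (-N : ℤ) N)) := by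
      ext k
      simp only [mem_Icc, mem_insert]
      omega
    rw [h, sum_insert (by simp; omega), sum_insert (by simp), ih, sum_Icc_succ_top (by omega)]
    rw [Int.natAbs_neg, Int.natAbs_natCast]
    ring

theorem mem_range_pentagonal_iff (n : ℕ) : (∃ k : ℤ, n = pentagonal k) ↔
    ∃ m : ℕ, n = m * (3 * m - 1) / 2 ∨ n = m * (3 * m + 1) / 2 := by
  have hpos (m : ℕ) : pentagonal m = m * (3 * m - 1) / 2 := by
    have h := natCast_pentagonal m
    rcases m with _ | m
    · simpa using h
    · apply Nat.cast_injective (R := ℤ)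
      rw [h]
      push_cast [show 1 ≤ 3 * (m + 1) by omega]
      rfl
  have hneg (m : ℕ) : pentagonal (-m) = m * (3 * m + 1) / 2 := by
    rw [pentagonal_neg]
    norm_cast
  constructor
  · rintro ⟨k, rfl⟩
    obtain ⟨m, rfl | rfl⟩ := k.eq_nat_or_neg
    · exact ⟨m, .inl (hpos m)⟩
    · exact ⟨m, .inr (hneg m)⟩
  · rintro ⟨m, h | h⟩
    · exact ⟨m, h.trans (hpos m).symm⟩
    · exact ⟨-m, h.trans (hneg m).symm⟩

open Classical in
theorem coeff_sum_X_pow_pentagonal {n N : ℕ} (hN : n ≤ N) :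
    (∑ k ∈ Icc (-N : ℤ) N, (X : ℤ⟦X⟧) ^ pentagonal k).coeff n =
      if ∃ k : ℤ, n = pentagonal k then 1 else 0 := by
  simp only [map_sum, coeff_X_pow]
  split_ifs with h
  · obtain ⟨k, rfl⟩ := h
    have := natAbs_le_pentagonal k
    simp only [pentagonal_inj, sum_ite_eq, mem_Icc]
    rw [if_pos (by omega)]
  · exact sum_eq_zero fun k _ ↦ if_neg fun hk ↦ h ⟨k, hk⟩

theorem coeff_distinctSeries_mul_sum {n N : ℕ} (hN : n ≤ N) :
    (distinctSeries * ∑ k ∈ Icc (-N : ℤ) N, (-1) ^ k.natAbs * X ^ (3 * k.natAbs ^ 2)).coeff n =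
      distinctPartitionCount n + 2 * ∑ k ∈ Icc 1 n, (-1 : ℤ) ^ k *
        (if 3 * k ^ 2 ≤ n then (distinctPartitionCount (n - 3 * k ^ 2) : ℤ) else 0) := by
  have hterm (k : ℕ) : (distinctSeries * ((-1) ^ k * X ^ (3 * k ^ 2))).coeff n = (-1 : ℤ) ^ k *
      (if 3 * k ^ 2 ≤ n then (distinctPartitionCount (n - 3 * k ^ 2) : ℤ) else 0) := by
    rw [show distinctSeries * ((-1) ^ k * X ^ (3 * k ^ 2)) =
      C ((-1 : ℤ) ^ k) * (distinctSeries * X ^ (3 * k ^ 2)) by simp; ring, coeff_C_mul,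
      coeff_mul_X_pow', distinctSeries, coeff_mk]
  simp only [mul_sum _ _ distinctSeries, map_sum, hterm]
  rw [sum_Icc_neg_natAbs fun k ↦ (-1 : ℤ) ^ k *
    (if 3 * k ^ 2 ≤ n then (distinctPartitionCount (n - 3 * k ^ 2) : ℤ) else 0)]
  congr 1
  · simp
  · congr 1
    refine (sum_subset (Icc_subset_Icc_right hN) fun k _ hk ↦ ?_).symm
    have hnk : n < k := by simp_all
    rw [if_neg (by nlinarith), mul_zero]

end Merca

open Classical in
/-- Merca's recurrence: for `n ≥ 1`,
`Q(n) = s(n) − 2·∑_{k=1}^{∞} (−1)^k Q(n − 3k²)`, where the sum is over positive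
`k` with `n − 3k² ≥ 0` (all such `k` satisfy `k ≤ n`), and `s(n) = 1` if `n` is
a generalized pentagonal number `m(3m±1)/2` and `s(n) = 0` otherwise. -/
theorem merca_recurrence (n : ℕ) (hn : 1 ≤ n) :
    (distinctPartitionCount n : ℤ) =
      (if (∃ m : ℕ, n = m * (3 * m - 1) / 2 ∨ n = m * (3 * m + 1) / 2) then 1 else 0) -
        2 * ∑ k ∈ Finset.Icc 1 n,
          (-1 : ℤ) ^ k *
            (if 3 * k ^ 2 ≤ n then (distinctPartitionCount (n - 3 * k ^ 2) : ℤ) else 0) := by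
  obtain ⟨N, hN, h⟩ := Merca.exists_coeff_distinctSeries_mul_sum n
  rw [Merca.coeff_distinctSeries_mul_sum hN, Merca.coeff_sum_X_pow_pentagonal hN] at h
  simp only [Merca.mem_range_pentagonal_iff] at h
  exact eq_sub_of_add_eq h
end
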